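/- For the AV-rule with lexicographic tie-breaking, if A is a lazy-PNE whose outcome W = W_A satisfies W ⊊ W*, then W is not equal to the set of the k highest-priority candidates of C under ▷. -/

import Mathlib

open Finset

/-- The 0-indexed rank of candidate `c` within committee `W` with respect to the utility `u`:
the number of members of `W` strictly preferred to `c`.  Thus the most preferred member of `W`
has rank `0`. -/
noncomputable def owaRank {C : Type*} (u : C → ℝ) (W : Finset C) (c : C) : ℕ :=
  (W.filter fun c' => u c < u c').card

/-- The OWA set-extension utility determined by the weights `lam` (where `lam 0` is the weight
`λ₁` put on the most preferred committee member, `lam 1` is `λ₂`, and so on) and the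
utility function `u`. -/
noncomputable def owaUtil {C : Type*} (lam : ℕ → ℝ) (u : C → ℝ) (W : Finset C) : ℝ :=
  ∑ c ∈ W, lam (owaRank u W c) * u c

/-- The approval score of candidate `c` under the ballot profile `A`. -/
def score {N C : Type*} [Fintype N] [DecidableEq C] (A : N → Finset C) (c : C) : ℕ :=
  (Finset.univ.filter fun i => c ∈ A i).card

/-- Candidate `c` is ranked above candidate `c'` by the best-`k` scoring rule with scoring
function `g`, with ties broken by the priority order: `c < c'` means `c` has higher
priority (`c ▷ c'`). -/
def beats {N C : Type*} [Fintype N] [DecidableEq C] [LT C]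
    (g : C → ℕ → ℝ) (A : N → Finset C) (c c' : C) : Prop :=
  g c' (score A c') < g c (score A c) ∨
    (g c (score A c) = g c' (score A c') ∧ c < c')

open Classical in
/-- The winning committee: the `k` top-ranked candidates. -/
noncomputable def winners {N C : Type*} [Fintype N] [Fintype C] [DecidableEq C] [LT C]
    (g : C → ℕ → ℝ) (k : ℕ) (A : N → Finset C) : Finset C :=
  Finset.univ.filter fun c => (Finset.univ.filter fun c' => beats g A c' c).card < k

/-- `B` is a best-response ballot of voter `i` against the other voters' ballots in `A`. -/
def BestResponse {N C : Type*} [Fintype N] [DecidableEq N] [Fintype C] [DecidableEq C] [LT C]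
    (g : C → ℕ → ℝ) (k : ℕ) (lam : ℕ → ℝ) (u : C → ℝ)
    (A : N → Finset C) (i : N) (B : Finset C) : Prop :=
  ∀ B' : Finset C,
    owaUtil lam u (winners g k (Function.update A i B')) ≤
      owaUtil lam u (winners g k (Function.update A i B))

/-- `B` is a minimal best-response ballot of voter `i`. -/
def MinimalBestResponse {N C : Type*} [Fintype N] [DecidableEq N] [Fintype C] [DecidableEq C]
    [LT C] (g : C → ℕ → ℝ) (k : ℕ) (lam : ℕ → ℝ) (u : C → ℝ)
    (A : N → Finset C) (i : N) (B : Finset C) : Prop :=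
  BestResponse g k lam u A i B ∧
    ∀ B' : Finset C, BestResponse g k lam u A i B' → B.card ≤ B'.card

/-- A ballot profile is a lazy pure Nash equilibrium if every voter's ballot is a minimal
best response to the other voters' ballots. -/
def LazyPNE {N C : Type*} [Fintype N] [DecidableEq N] [Fintype C] [DecidableEq C] [LT C]
    (g : C → ℕ → ℝ) (k : ℕ) (lam : N → ℕ → ℝ) (u : N → C → ℝ) (A : N → Finset C) : Prop :=
  ∀ i, MinimalBestResponse g k (lam i) (u i) A i (A i)

/-- A ballot is sincere if every approved candidate is preferred to every unapproved one. -/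
def Sincere {C : Type*} (u : C → ℝ) (B : Finset C) : Prop :=
  ∀ c ∈ B, ∀ c' ∉ B, u c' < u c

/-- Approval voting ranks the candidates by the number of approvals, ties broken by priority. -/
theorem beats_approval_iff {N C : Type*} [Fintype N] [DecidableEq C] [LT C]
    (A : N → Finset C) (c c' : C) :
    beats (fun _ n => (n : ℝ)) A c c' ↔
      score A c' < score A c ∨ (score A c = score A c' ∧ c < c') := by
  simp [beats]

/-- A set of `k` candidates each of which beats all the others is the winning committee. -/
theorem winners_eq_of_beats {N C : Type*} [Fintype N] [Fintype C] [LinearOrder C]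
    {k : ℕ} {A : N → Finset C} {S : Finset C} (hS : S.card = k)
    (h : ∀ c ∈ S, ∀ c' ∉ S, beats (fun _ n => (n : ℝ)) A c c') :
    winners (fun _ n => (n : ℝ)) k A = S := by
  classical
  ext c
  simp only [winners, mem_filter, mem_univ, true_and]
  constructor
  · intro hc
    by_contra hcS
    have hsub : S ⊆ univ.filter fun c' => beats (fun _ n => (n : ℝ)) A c' c := fun c' hc' => by
      simpa using h c' hc' c hcS
    have := card_le_card hsub
    rw [hS] at this
    exact absurd (lt_of_lt_of_le (by convert hc) this) (lt_irrefl _)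
  · intro hc
    have hsub : (univ.filter fun c' => beats (fun _ n => (n : ℝ)) A c' c) ⊂ S := by
      refine ⟨fun c' hc' => ?_, fun hs => ?_⟩
      · by_contra hn
        have h1 := h c hc c' hn
        have h2 : beats (fun _ n => (n : ℝ)) A c' c := by simpa using hc'
        rw [beats_approval_iff] at h1 h2
        rcases h1 with h1 | h1 <;> rcases h2 with h2 | h2
        · omega
        · omega
        · omega
        · exact lt_asymm h1.2 h2.2
      · have h1 : beats (fun _ n => (n : ℝ)) A c c := by simpa using hs hc
        rw [beats_approval_iff] at h1
        simp at h1
    have := card_lt_card hsub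
    rw [hS] at this
    convert this

/-- Every winner beats every loser. -/
theorem beats_of_mem_winners {N C : Type*} [Fintype N] [Fintype C] [LinearOrder C]
    {k : ℕ} {A : N → Finset C} {c c' : C} (hc : c ∈ winners (fun _ n => (n : ℝ)) k A)
    (hc' : c' ∉ winners (fun _ n => (n : ℝ)) k A) :
    beats (fun _ n => (n : ℝ)) A c c' := by
  classical
  by_contra hb
  apply hc'
  simp only [winners, mem_filter, mem_univ, true_and] at hc ⊢
  refine lt_of_le_of_lt (card_le_card fun d hd => ?_) hc
  simp only [mem_filter, mem_univ, true_and, beats_approval_iff] at hd ⊢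
  rw [beats_approval_iff] at hb
  push Not at hb
  obtain ⟨h1, h2⟩ := hb
  rcases lt_or_eq_of_le h1 with h1 | h1
  · rcases hd with hd | hd <;> left <;> omega
  · have h3 := h2 h1
    rcases hd with hd | hd
    · left; omega
    · right; exact ⟨by omega, lt_of_lt_of_le hd.2 h3⟩

/-- A minimal best response approves winners only. -/
theorem MinimalBestResponse.subset_winners {N C : Type*} [Fintype N] [DecidableEq N] [Fintype C]
    [LinearOrder C] {k : ℕ} {lam : ℕ → ℝ} {u : C → ℝ} {A : N → Finset C} {i : N}
    (h : MinimalBestResponse (fun _ n => (n : ℝ)) k lam u A i (A i))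
    (hcard : (winners (fun _ n => (n : ℝ)) k A).card = k) :
    A i ⊆ winners (fun _ n => (n : ℝ)) k A := by
  set W := winners (fun _ n => (n : ℝ)) k A with hW
  have hle : ∀ c, score (Function.update A i (A i ∩ W)) c ≤ score A c := fun c => by
    refine card_le_card fun j hj => ?_
    simp only [mem_filter, mem_univ, true_and] at hj ⊢
    by_cases hji : j = i
    · subst hji
      simp at hj
      exact hj.1
    · simpa [hji] using hj
  have hge : ∀ c ∈ W, score A c ≤ score (Function.update A i (A i ∩ W)) c := fun c hc => by
    refine card_le_card fun j hj => ?_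
    simp only [mem_filter, mem_univ, true_and] at hj ⊢
    by_cases hji : j = i
    · subst hji
      simp [hj, hc]
    · simpa [hji] using hj
  have hwin : winners (fun _ n => (n : ℝ)) k (Function.update A i (A i ∩ W)) = W := by
    refine winners_eq_of_beats hcard fun c hc c' hc' => ?_
    have hb := beats_of_mem_winners hc hc'
    rw [beats_approval_iff] at hb ⊢
    have h1 := hle c
    have h2 := hge c hc
    have h3 := hle c'
    rcases hb with hb | hb
    · left; omega
    · rcases lt_or_eq_of_le h3 with h3 | h3
      · left; omega
      · right; exact ⟨by omega, hb.2⟩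
  have hbr : BestResponse (fun _ n => (n : ℝ)) k lam u A i (A i ∩ W) := fun B' => by
    have := h.1 B'
    rwa [Function.update_eq_self, ← hW, ← hwin] at this
  exact inter_eq_left.mp (eq_of_subset_of_card_le inter_subset_left (h.2 _ hbr))

/-- If the winners are the top-priority candidates, all ballots of a lazy equilibrium are empty. -/
theorem LazyPNE.eq_empty {N C : Type*} [Fintype N] [DecidableEq N] [Fintype C]
    [LinearOrder C] {k : ℕ} {lam : N → ℕ → ℝ} {u : N → C → ℝ} {A : N → Finset C} {T : Finset C}
    (h : LazyPNE (fun _ n => (n : ℝ)) k lam u A) (hT : T.card = k)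
    (hTtop : ∀ c ∈ T, ∀ c' ∉ T, c < c') (hW : winners (fun _ n => (n : ℝ)) k A = T) (i : N) :
    A i = ∅ := by
  have hsub : ∀ j, A j ⊆ T := fun j => hW ▸ (h j).subset_winners (hW.symm ▸ hT)
  have hwin : winners (fun _ n => (n : ℝ)) k (Function.update A i ∅) = T := by
    refine winners_eq_of_beats hT fun c hc c' hc' => ?_
    rw [beats_approval_iff]
    have hzero : score (Function.update A i ∅) c' = 0 := by
      refine card_eq_zero.mpr (filter_eq_empty_iff.mpr fun j _ hj => ?_)
      by_cases hji : j = i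
      · subst hji
        simp at hj
      · exact hc' (hsub j (by simpa [hji] using hj))
    rcases Nat.eq_zero_or_pos (score (Function.update A i ∅) c) with h0 | h0
    · right; exact ⟨by omega, hTtop c hc c' hc'⟩
    · left; omega
  have hbr : BestResponse (fun _ n => (n : ℝ)) k (lam i) (u i) A i ∅ := fun B' => by
    have := (h i).1 B'
    rwa [Function.update_eq_self, hW, ← hwin] at this
  simpa using (h i).2 _ hbr

/-- A voter facing only empty ballots can elect any `k` candidates. -/
theorem winners_update_of_forall_eq_empty {N C : Type*} [Fintype N] [DecidableEq N] [Fintype C]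
    [LinearOrder C] {k : ℕ} {A : N → Finset C} (hA : ∀ j, A j = ∅) (i : N) {B : Finset C}
    (hB : B.card = k) : winners (fun _ n => (n : ℝ)) k (Function.update A i B) = B := by
  refine winners_eq_of_beats hB fun c hc c' hc' => ?_
  rw [beats_approval_iff]
  left
  have h0 : score (Function.update A i B) c' = 0 := by
    refine card_eq_zero.mpr (filter_eq_empty_iff.mpr fun j _ hj => ?_)
    by_cases hji : j = i
    · subst hji
      simp [hc'] at hj
    · simp [hji, hA] at hj
  have h1 : 0 < score (Function.update A i B) c := card_pos.mpr ⟨i, by simp [hc]⟩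
  omega

theorem owaRank_lt_card {C : Type*} (u : C → ℝ) {W : Finset C} {c : C} (hc : c ∈ W) :
    owaRank u W c < W.card :=
  card_lt_card ⟨filter_subset _ _, fun h => by simpa using h hc⟩

theorem owaRank_lt_owaRank {C : Type*} (u : C → ℝ) {W : Finset C} {c d : C} (hd : d ∈ W)
    (h : u c < u d) : owaRank u W d < owaRank u W c := by
  refine card_lt_card ⟨fun e he => ?_, fun hs => ?_⟩
  · simp only [mem_filter] at he ⊢
    exact ⟨he.1, h.trans he.2⟩
  · have : d ∈ W.filter fun c' => u d < u c' := hs (by simp [hd, h])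
    simp at this

theorem owaRank_injOn {C : Type*} {u : C → ℝ} (hu : Function.Injective u) (W : Finset C) :
    Set.InjOn (owaRank u W) W := fun c hc d hd h => by
  rcases lt_trichotomy (u c) (u d) with hlt | heq | hlt
  · exact absurd h (owaRank_lt_owaRank u hd hlt).ne'
  · exact hu heq
  · exact absurd h (owaRank_lt_owaRank u hc hlt).ne

theorem image_owaRank {C : Type*} {u : C → ℝ} (hu : Function.Injective u) (W : Finset C) :
    W.image (owaRank u W) = range W.card :=
  eq_of_subset_of_card_le
    (fun n hn => by
      obtain ⟨c, hc, rfl⟩ := mem_image.mp hn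
      exact mem_range.mpr (owaRank_lt_card u hc))
    (by rw [card_range, card_image_of_injOn (owaRank_injOn hu W)])

/-- A committee can be listed by rank, and its utility is the weighted sum along that listing. -/
theorem exists_rank_enumeration {C : Type*} {u : C → ℝ} (hu : Function.Injective u)
    {W : Finset C} (hW : W.Nonempty) :
    ∃ e : ℕ → C, (∀ n < W.card, e n ∈ W ∧ owaRank u W (e n) = n) ∧
      ∀ lam : ℕ → ℝ, owaUtil lam u W = ∑ n ∈ range W.card, lam n * u (e n) := by
  have hex : ∀ n, ∃ c, n < W.card → c ∈ W ∧ owaRank u W c = n := fun n => by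
    by_cases hn : n < W.card
    · have : n ∈ W.image (owaRank u W) := by rw [image_owaRank hu]; exact mem_range.mpr hn
      obtain ⟨c, hc⟩ := mem_image.mp this
      exact ⟨c, fun _ => hc⟩
    · exact ⟨hW.choose, fun h => absurd h hn⟩
  choose e he using hex
  refine ⟨e, he, fun lam => ?_⟩
  rw [owaUtil, ← image_owaRank hu W, sum_image (owaRank_injOn hu W)]
  refine sum_congr rfl fun c hc => ?_
  have h := he _ (owaRank_lt_card u hc)
  rw [owaRank_injOn hu W h.1 hc h.2]

/-- A committee containing the `j` most preferred candidates is strictly better than one of the same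
size missing some of them, when `j` is the last rank with positive weight. -/
theorem owaUtil_lt_of_top_subset {C : Type*} {u : C → ℝ} (hu : Function.Injective u)
    {lam : ℕ → ℝ} (hlam : ∀ n, 0 ≤ lam n) {j : ℕ} (hj : 1 ≤ j) (hz : ∀ n, j ≤ n → lam n = 0)
    (hpos : 0 < lam (j - 1)) {P V W : Finset C} (hP : P.card = j)
    (hPtop : ∀ c ∈ P, ∀ c' ∉ P, u c' < u c) (hPV : P ⊆ V) (hVW : W.card = V.card)
    (hPW : ¬ P ⊆ W) : owaUtil lam u W < owaUtil lam u V := by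
  classical
  have hjV : j ≤ V.card := hP ▸ card_le_card hPV
  have hVne : V.Nonempty := card_pos.mp (by omega)
  have hWne : W.Nonempty := card_pos.mp (by omega)
  obtain ⟨e, he, hesum⟩ := exists_rank_enumeration hu hWne
  obtain ⟨f, hf, hfsum⟩ := exists_rank_enumeration hu hVne
  have hfP : ∀ n < j, f n ∈ P := fun n hn => by
    by_contra hnP
    have h1 : P ⊆ V.filter fun c' => u (f n) < u c' := fun c hc =>
      mem_filter.mpr ⟨hPV hc, hPtop c hc _ hnP⟩
    have h2 := card_le_card h1
    have h3 := (hf n (by omega)).2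
    rw [owaRank] at h3
    omega
  have habove : ∀ n < j, ∀ c, u (f n) ≤ u c → c ∈ P := fun n hn c hc => by
    by_contra hcP
    exact absurd (hPtop _ (hfP n hn) c hcP) (not_lt.mpr hc)
  have hcount : ∀ n < W.card, (insert (e n) (W.filter fun c' => u (e n) < u c')).card = n + 1 :=
    fun n hn => by
      rw [card_insert_of_notMem (by simp)]
      have h := (he n hn).2
      rw [owaRank] at h
      omega
  have hmem : ∀ n c, c ∈ insert (e n) (W.filter fun c' => u (e n) < u c') → u (e n) ≤ u c :=
    fun n c hc => by
      rcases mem_insert.mp hc with rfl | hc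
      · exact le_rfl
      · exact (mem_filter.mp hc).2.le
  have hle : ∀ n < j, u (e n) ≤ u (f n) := fun n hn => by
    by_contra! hlt
    have h1 : insert (e n) (W.filter fun c' => u (e n) < u c') ⊆
        V.filter fun c' => u (f n) < u c' := fun c hc => by
      have h := hlt.trans_le (hmem n c hc)
      exact mem_filter.mpr ⟨hPV (habove n hn c h.le), h⟩
    have h2 := card_le_card h1
    have h3 := (hf n (by omega)).2
    rw [owaRank] at h3
    rw [hcount n (by omega)] at h2
    omega
  have hlt : u (e (j - 1)) < u (f (j - 1)) := by
    refine lt_of_le_of_ne (hle _ (by omega)) fun heq => hPW ?_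
    have h1 : insert (e (j - 1)) (W.filter fun c' => u (e (j - 1)) < u c') ⊆ P := fun c hc =>
      habove (j - 1) (by omega) c (heq ▸ hmem _ c hc)
    have h2 := eq_of_subset_of_card_le h1 (by rw [hcount _ (by omega)]; omega)
    rw [← h2]
    exact insert_subset (he _ (by omega)).1 (filter_subset _ _)
  rw [hesum, hfsum, hVW]
  refine sum_lt_sum (fun n _ => ?_) ⟨j - 1, mem_range.mpr (by omega), ?_⟩
  · rcases lt_or_ge n j with hn | hn
    · exact mul_le_mul_of_nonneg_left (hle n hn) (hlam n)
    · simp [hz n hn]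
  · exact mul_lt_mul_of_pos_left hlt hpos

/-- if a lazy-PNE outcome `W` of the AV-rule satisfies `W ⊊ W*`, then `W` is not
the set of the `k` highest-priority candidates. -/
theorem statement_13 {N C : Type*} [Fintype N] [DecidableEq N] [Fintype C] [LinearOrder C]
    (k : ℕ) (hk1 : 1 ≤ k) (hk2 : k ≤ Fintype.card C)
    (u : N → C → ℝ) (hu : ∀ i, Function.Injective (u i))
    (lam : N → ℕ → ℝ) (hlam : ∀ i n, 0 ≤ lam i n)
    (jstar : N → ℕ) (hj1 : ∀ i, 1 ≤ jstar i) (hjk : ∀ i, jstar i ≤ k)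
    (hz : ∀ i n, jstar i ≤ n → lam i n = 0)
    (hpos : ∀ i, 0 < lam i (jstar i - 1))
    (Wst : N → Finset C) (hWstcard : ∀ i, (Wst i).card = jstar i)
    (hWsttop : ∀ i, ∀ c ∈ Wst i, ∀ c' ∉ Wst i, u i c' < u i c)
    (T : Finset C) (hTcard : T.card = k) (hTtop : ∀ c ∈ T, ∀ c' ∉ T, c < c')
    (A : N → Finset C) (hPNE : LazyPNE (fun _ n => (n : ℝ)) k lam u A)
    (hssub : winners (fun _ n => (n : ℝ)) k A ⊂ Finset.univ.biUnion Wst) :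
    winners (fun _ n => (n : ℝ)) k A ≠ T := by
  intro hWT
  have hempty := fun i => hPNE.eq_empty hTcard hTtop hWT i
  obtain ⟨-, hnot⟩ := hssub
  obtain ⟨a, ha, haW⟩ := not_subset.mp hnot
  obtain ⟨i, -, hai⟩ := mem_biUnion.mp ha
  obtain ⟨B, hPB, -, hB⟩ := exists_subsuperset_card_eq (subset_univ (Wst i))
    ((hWstcard i).trans_le (hjk i)) (by rwa [card_univ])
  have hbr := (hPNE i).1 B
  rw [winners_update_of_forall_eq_empty hempty i hB, Function.update_eq_self, hWT] at hbr
  exact absurd hbr (not_le.mpr (owaUtil_lt_of_top_subset (hu i) (hlam i) (hj1 i) (hz i) (hpos i)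
    (hWstcard i) (hWsttop i) hPB (hTcard.trans hB.symm) fun h => haW (hWT ▸ h hai)))
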